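/- arXiv:2105.07477 — 2 statements merged into one kernel-verified Lean document; each statement's English description precedes it below -/
import Mathlib

section
/- The double series ∑_{j,k odd} 1/( j²k²(j² + k²) ) over all pairs of odd positive integers converges and equals (1 − 2⁻⁴)(1 − 2⁻²)·ζ(4)ζ(2) − (π/2)·∑_{k odd} (1/k⁵)·coth(kπ) + (π/4)·∑_{k odd} (1/k⁵)·coth(kπ/2), where the single sums run over odd positive integers k. -/
open Real

/-- Hyperbolic cotangent. -/
noncomputable def coth (x : ℝ) : ℝ := Real.cosh x / Real.sinh x

/-- Riemann zeta value at a positive integer `s > 1`, as the real Dirichlet series. -/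
noncomputable def zetaR (s : ℕ) : ℝ := ∑' n : ℕ, 1 / ((n : ℝ) + 1) ^ s

lemma aux_congr {ι : Type} {f g : ι → ℝ} {a b : ℝ} (h : HasSum f a)
    (hfg : ∀ n, g n = f n) (hab : b = a) : HasSum g b := by
  rw [funext hfg, hab]
  exact h

lemma aux_congrC {ι : Type} {f g : ι → ℂ} {a b : ℂ} (h : HasSum f a)
    (hfg : ∀ n, g n = f n) (hab : b = a) : HasSum g b := by
  rw [funext hfg, hab]
  exact h

lemma aux_coth_series (a : ℝ) (ha : 0 < a) :
    HasSum (fun n : ℕ => 1 / (((n : ℝ) + 1) ^ 2 + a ^ 2))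
      (π / (2 * a) * coth (a * π) - 1 / (2 * a ^ 2)) := by
  have hz : ((a : ℂ) * Complex.I) ∈ Complex.integerComplement := by
    rintro ⟨m, hm⟩
    have := congrArg Complex.im hm
    simp at this
    exact ha.ne this
  have h1 := (summable_cotTerm hz).hasSum
  have h2 := cot_series_rep' hz
  change _ = ∑' n : ℕ, cotTerm ((a : ℂ) * Complex.I) n at h2
  rw [← h2] at h1
  have haC : (a : ℂ) ≠ 0 := by exact_mod_cast ha.ne'
  have hs : Real.sinh (a * π) ≠ 0 := by
    have : 0 < Real.sinh (a * π) := Real.sinh_pos_iff.2 (by positivity)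
    exact this.ne'
  have hsC : Complex.sinh ((a : ℂ) * π) ≠ 0 := by exact_mod_cast hs
  have h3 := h1.mul_left (Complex.I / (2 * a))
  rw [← Complex.hasSum_ofReal]
  refine aux_congrC h3 ?_ ?_
  · intro n
    rw [cotTerm_identity hz]
    have hn : (((n : ℂ) + 1) ^ 2 + (a : ℂ) ^ 2) ≠ 0 := by
      have : ((n : ℝ) + 1) ^ 2 + a ^ 2 ≠ 0 := by positivity
      exact_mod_cast this
    have e : ((a : ℂ) * Complex.I + (n + 1)) * ((a : ℂ) * Complex.I - (n + 1))
        = -(((n : ℂ) + 1) ^ 2 + (a : ℂ) ^ 2) := by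
      linear_combination (a : ℂ) ^ 2 * Complex.I_sq
    rw [e]
    push_cast
    field_simp
    rw [Complex.I_sq, neg_neg]
  · have e : (π : ℂ) * (a * Complex.I) = (a * π : ℂ) * Complex.I := by ring
    rw [e, Complex.cot, Complex.cos_mul_I, Complex.sin_mul_I, coth]
    push_cast
    have := Complex.I_ne_zero
    field_simp

lemma aux_odd (f : ℝ → ℝ) (A B : ℝ) (hA : HasSum (fun n : ℕ => f ((n : ℝ) + 1)) A)
    (hB : HasSum (fun n : ℕ => f (2 * ((n : ℝ) + 1))) B) :
    HasSum (fun n : ℕ => f (2 * (n : ℝ) + 1)) (A - B) := by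
  have hi : Function.Injective (fun n : ℕ => 2 * n) := fun x y h => by simpa using h
  have hs : Summable (fun n : ℕ => f (2 * (n : ℝ) + 1)) := by
    have := hA.summable.comp_injective hi
    refine this.congr fun n => ?_
    simp
  have h := HasSum.even_add_odd (f := fun n : ℕ => f ((n : ℝ) + 1))
    (m := ∑' n : ℕ, f (2 * (n : ℝ) + 1)) (m' := B)
    (by simpa using hs.hasSum)
    (by
      convert hB using 3 with n
      push_cast; ring)
  have := h.unique hA
  rw [← this]
  simpa using hs.hasSum

lemma aux_odd_coth (a : ℝ) (ha : 0 < a) :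
    HasSum (fun n : ℕ => 1 / ((2 * (n : ℝ) + 1) ^ 2 + a ^ 2))
      (π / (2 * a) * coth (a * π) - π / (4 * a) * coth (a * π / 2)) := by
  have h1 := aux_coth_series a ha
  have h2 := (aux_coth_series (a / 2) (by positivity)).mul_left (1 / 4)
  have h := aux_odd (fun x => 1 / (x ^ 2 + a ^ 2)) _
    (1 / 4 * (π / (2 * (a / 2)) * coth (a / 2 * π) - 1 / (2 * (a / 2) ^ 2))) h1 (by
      refine aux_congr h2 (fun n => ?_) rfl
      field_simp
      ring)
  refine aux_congr h (fun _ => rfl) ?_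
  rw [show a / 2 * π = a * π / 2 by ring]
  field_simp
  ring

lemma aux_odd_zeta (s : ℕ) (hs : 2 ≤ s) :
    HasSum (fun n : ℕ => 1 / (2 * (n : ℝ) + 1) ^ s) ((1 - 1 / 2 ^ s) * zetaR s) := by
  have h0 : Summable (fun n : ℕ => 1 / ((n : ℝ) + 1) ^ s) := by
    have := (summable_nat_add_iff 1).2 (Real.summable_one_div_nat_pow.2 (show 1 < s by omega))
    simpa using this
  have h1 := h0.hasSum
  have h := aux_odd (fun x => 1 / x ^ s) _ (1 / 2 ^ s * zetaR s) h1 (by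
    refine aux_congr (h1.mul_left (1 / 2 ^ s)) (fun n => ?_) rfl
    rw [mul_pow]
    field_simp)
  refine aux_congr h (fun _ => rfl) ?_
  unfold zetaR
  ring

lemma aux_coth_bound (x : ℝ) (hx : 1 ≤ x) : 0 ≤ coth x ∧ coth x ≤ 2 := by
  have h1 : x ≤ Real.sinh x := Real.self_le_sinh_iff.2 (by linarith)
  have h2 : 0 < Real.sinh x := by linarith
  have h3 : Real.cosh x - Real.sinh x = Real.exp (-x) := Real.cosh_sub_sinh x
  have h4 : Real.exp (-x) ≤ 1 := Real.exp_le_one_iff.2 (by linarith)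
  have h5 := Real.cosh_pos x
  unfold coth
  refine ⟨by positivity, ?_⟩
  rw [div_le_iff₀ h2]
  linarith

lemma aux_summable (g : ℕ → ℝ) (hg : ∀ k, 1 ≤ g k) :
    Summable (fun k : ℕ => (1 / (2 * (k : ℝ) + 1) ^ 5) * coth (g k)) := by
  refine Summable.of_nonneg_of_le (fun k => ?_) (fun k => ?_)
    ((aux_odd_zeta 5 (by norm_num)).summable.mul_right 2)
  · have := (aux_coth_bound _ (hg k)).1
    positivity
  · have := (aux_coth_bound _ (hg k)).2
    gcongr

/-- The double series over pairs of odd positive integers `j = 2m+1`, `k = 2n+1` of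
`1/(j²k²(j² + k²))` converges and equals
`(1 − 2⁻⁴)(1 − 2⁻²)ζ(4)ζ(2) − (π/2)∑_{k odd}(1/k⁵)coth(kπ) + (π/4)∑_{k odd}(1/k⁵)coth(kπ/2)`. -/
theorem double_sum_odd_pairs :
    HasSum
      (fun p : ℕ × ℕ =>
        1 / ((2 * (p.1 : ℝ) + 1) ^ 2 * (2 * (p.2 : ℝ) + 1) ^ 2 *
          ((2 * (p.1 : ℝ) + 1) ^ 2 + (2 * (p.2 : ℝ) + 1) ^ 2)))
      ((1 - 1 / 2 ^ 4) * (1 - 1 / 2 ^ 2) * (zetaR 4 * zetaR 2) -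
        (π / 2) * ∑' k : ℕ, (1 / (2 * (k : ℝ) + 1) ^ 5) * coth ((2 * (k : ℝ) + 1) * π) +
        (π / 4) * ∑' k : ℕ, (1 / (2 * (k : ℝ) + 1) ^ 5) * coth ((2 * (k : ℝ) + 1) * π / 2)) := by
  have h4 := aux_odd_zeta 4 (by norm_num)
  have h2 := aux_odd_zeta 2 (by norm_num)
  have hP : Summable (fun p : ℕ × ℕ =>
      (1 / (2 * (p.1 : ℝ) + 1) ^ 4) * (1 / (2 * (p.2 : ℝ) + 1) ^ 2)) :=
    h4.summable.mul_of_nonneg h2.summable (fun n => by positivity) (fun n => by positivity)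
  have hprod := h4.mul h2 hP
  have hQ : Summable (fun p : ℕ × ℕ =>
      (1 / (2 * (p.1 : ℝ) + 1) ^ 4) *
        (1 / ((2 * (p.2 : ℝ) + 1) ^ 2 + (2 * (p.1 : ℝ) + 1) ^ 2))) := by
    refine Summable.of_nonneg_of_le (fun p => by positivity) (fun p => ?_) hP
    gcongr
    exact le_add_of_nonneg_right (by positivity)
  have hpi := Real.pi_gt_three
  have hc1 := (aux_summable (fun k : ℕ => (2 * (k : ℝ) + 1) * π) (fun k => by
    have : (0 : ℝ) ≤ k := Nat.cast_nonneg k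
    nlinarith)).hasSum.mul_left (π / 2)
  have hc2 := (aux_summable (fun k : ℕ => (2 * (k : ℝ) + 1) * π / 2) (fun k => by
    have : (0 : ℝ) ≤ k := Nat.cast_nonneg k
    nlinarith)).hasSum.mul_left (π / 4)
  have hf : ∀ k : ℕ, HasSum (fun n : ℕ => (1 / (2 * (k : ℝ) + 1) ^ 4) *
        (1 / ((2 * (n : ℝ) + 1) ^ 2 + (2 * (k : ℝ) + 1) ^ 2)))
      (π / 2 * (1 / (2 * (k : ℝ) + 1) ^ 5 * coth ((2 * (k : ℝ) + 1) * π)) -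
       π / 4 * (1 / (2 * (k : ℝ) + 1) ^ 5 * coth ((2 * (k : ℝ) + 1) * π / 2))) := by
    intro k
    have hk : (0 : ℝ) < 2 * (k : ℝ) + 1 := by positivity
    refine aux_congr ((aux_odd_coth _ hk).mul_left (1 / (2 * (k : ℝ) + 1) ^ 4)) (fun _ => rfl) ?_
    field_simp
  have hQs := hQ.hasSum.prod_fiberwise hf
  have hQv := hQs.unique (hc1.sub hc2)
  have hQh := hQ.hasSum
  rw [hQv] at hQh
  refine aux_congr (hprod.sub hQh) ?_ ?_
  · intro p
    have hk : (0 : ℝ) < 2 * (p.1 : ℝ) + 1 := by positivity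
    have hj : (0 : ℝ) < 2 * (p.2 : ℝ) + 1 := by positivity
    field_simp
    ring
  · ring
end

section
/- The real number 1/60 − (3/(4π⁵))·∑_{k=1}^∞ (1/k⁵)·tanh(kπ) − (24/π⁵)·∑_{k odd} (1/k⁵)·coth(kπ/2) − (16/π⁵)·∑_{k odd} (1/k⁵)·( tanh(kπ/2) − tanh(kπ/4) ) is strictly negative. -/
open Real

theorem coth_bounds {x : ℝ} (hx : 1 ≤ x) : 1 ≤ coth x ∧ coth x ≤ 2 := by
  have h1 : x ≤ Real.sinh x := Real.self_le_sinh_iff.mpr (by linarith)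
  have h0 : 0 < Real.sinh x := by linarith
  have h2 : Real.cosh x - Real.sinh x = Real.exp (-x) := Real.cosh_sub_sinh x
  have h3 : 0 < Real.exp (-x) := Real.exp_pos _
  have h4 : Real.exp (-x) ≤ 1 := Real.exp_le_one_iff.mpr (by linarith)
  unfold coth
  constructor
  · rw [le_div_iff₀ h0]; linarith
  · rw [div_le_iff₀ h0]; linarith

theorem arg_ge (k : ℕ) : 1 ≤ (2 * (k : ℝ) + 1) * π / 2 := by
  have := Real.pi_gt_three
  have hk : (0 : ℝ) ≤ k := Nat.cast_nonneg k
  nlinarith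

theorem tanh_mono' {x y : ℝ} (h : x ≤ y) : Real.tanh x ≤ Real.tanh y := by
  rw [Real.tanh_eq_sinh_div_cosh, Real.tanh_eq_sinh_div_cosh,
    div_le_div_iff₀ (Real.cosh_pos x) (Real.cosh_pos y)]
  have h1 := Real.sinh_sub y x
  have h2 : 0 ≤ Real.sinh (y - x) := Real.sinh_nonneg_iff.mpr (by linarith)
  nlinarith

theorem summable_odd :
    Summable fun k : ℕ => (1 / (2 * (k : ℝ) + 1) ^ 5) * coth ((2 * (k : ℝ) + 1) * π / 2) := by
  have hs : Summable fun k : ℕ => 2 * (1 / ((k : ℝ) + 1) ^ 5) := by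
    have h := (summable_nat_add_iff 1).mpr
      (Real.summable_one_div_nat_pow.mpr (by norm_num : 1 < 5))
    refine Summable.mul_left 2 ?_
    simpa using h
  refine Summable.of_nonneg_of_le (fun k => ?_) (fun k => ?_) hs
  · have := (coth_bounds (arg_ge k)).1
    positivity
  · have hb := coth_bounds (arg_ge k)
    have hk : (0 : ℝ) ≤ k := Nat.cast_nonneg k
    rw [mul_comm]
    have h5 : 1 / (2 * (k : ℝ) + 1) ^ 5 ≤ 1 / ((k : ℝ) + 1) ^ 5 := by
      apply one_div_le_one_div_of_le (by positivity)
      gcongr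
      linarith
    exact mul_le_mul hb.2 h5 (by positivity) (by norm_num)

theorem chapman_difference_neg :
    1 / 60 -
      (3 / (4 * π ^ 5)) *
        ∑' k : ℕ, (1 / ((k : ℝ) + 1) ^ 5) * Real.tanh (((k : ℝ) + 1) * π) -
      (24 / π ^ 5) *
        ∑' k : ℕ, (1 / (2 * (k : ℝ) + 1) ^ 5) * coth ((2 * (k : ℝ) + 1) * π / 2) -
      (16 / π ^ 5) *
        ∑' k : ℕ, (1 / (2 * (k : ℝ) + 1) ^ 5) *
          (Real.tanh ((2 * (k : ℝ) + 1) * π / 2) -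
            Real.tanh ((2 * (k : ℝ) + 1) * π / 4)) < 0 := by
  have hpi := Real.pi_pos
  have hA : 0 ≤ ∑' k : ℕ, (1 / ((k : ℝ) + 1) ^ 5) * Real.tanh (((k : ℝ) + 1) * π) := by
    refine tsum_nonneg fun k => mul_nonneg (by positivity) ?_
    have := tanh_mono' (show (0 : ℝ) ≤ ((k : ℝ) + 1) * π by positivity)
    simpa using this
  have hC : 0 ≤ ∑' k : ℕ, (1 / (2 * (k : ℝ) + 1) ^ 5) *
          (Real.tanh ((2 * (k : ℝ) + 1) * π / 2) -
            Real.tanh ((2 * (k : ℝ) + 1) * π / 4)) := by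
    refine tsum_nonneg fun k => mul_nonneg (by positivity) ?_
    have h0 : 0 ≤ (2 * (k : ℝ) + 1) * π := by positivity
    exact sub_nonneg.mpr (tanh_mono' (by linarith))
  have hB : 1 ≤ ∑' k : ℕ, (1 / (2 * (k : ℝ) + 1) ^ 5) * coth ((2 * (k : ℝ) + 1) * π / 2) := by
    have h := summable_odd.le_tsum 0 (fun k _ => by
      have := (coth_bounds (arg_ge k)).1
      positivity)
    refine le_trans ?_ h
    have := (coth_bounds (arg_ge 0)).1
    simpa using this
  have hp : 1 / 60 < 24 / π ^ 5 := by
    rw [div_lt_div_iff₀ (by norm_num) (by positivity)]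
    have h : π ^ 5 < 3.15 ^ 5 := by
      gcongr
      exact Real.pi_lt_d2
    norm_num at h ⊢
    linarith
  have h1 := mul_nonneg (show 0 ≤ 3 / (4 * π ^ 5) by positivity) hA
  have h2 := mul_nonneg (show 0 ≤ 16 / π ^ 5 by positivity) hC
  have h3 := mul_le_mul_of_nonneg_left hB (show 0 ≤ 24 / π ^ 5 by positivity)
  linarith
end
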